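/- arXiv:2012.14174 — 2 statements merged into one kernel-verified Lean document; each statement's English description precedes it below -/
import Mathlib

section
/- Let I = (G, A, B, u_A, u_B, k) be an instance of bounded-degree cut. Then there exists a family 𝒫 of at most 2^{12k} pairs (X1, X2) of disjoint subsets of V with X1 ⊆ Z_A and X2 ⊆ Z_B such that for every feasible (A,B)-cut (V1, V2) of I, the pair (Z_A ∩ V1, Z_B ∩ V2) belongs to 𝒫. -/
open Finset

variable {V : Type*} [Fintype V] [DecidableEq V]

/-- Cut-size of the cut `(V1, V ∖ V1)`. -/
def cutSize (w : V → V → ℕ) (V1 : Finset V) : ℕ :=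
  ∑ u ∈ V1, ∑ v ∈ V1ᶜ, w u v

/-- Boundary `δ(X)`: unordered pairs `{u,v}` with `u ∈ X`, `v ∉ X`, `w u v > 0`. -/
def bdry (w : V → V → ℕ) (X : Finset V) : Set (Sym2 V) :=
  {e | ∃ u v, e = s(u, v) ∧ u ∈ X ∧ v ∉ X ∧ 0 < w u v}

/-- `(A,B)`-cut, represented by its first part `V1` (the second part is `V1ᶜ`). -/
def IsCut (A B V1 : Finset V) : Prop := A ⊆ V1 ∧ B ⊆ V1ᶜ

/-- Minimal `(A,B)`-cut. -/
def IsMinimalCut (w : V → V → ℕ) (A B V1 : Finset V) : Prop :=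
  IsCut A B V1 ∧
  (¬ ∃ V1' : Finset V, A ⊆ V1' ∧ V1' ⊂ V1 ∧ bdry w V1' ⊆ bdry w V1) ∧
  (¬ ∃ V2' : Finset V, B ⊆ V2' ∧ V2' ⊂ V1ᶜ ∧ bdry w V2' ⊆ bdry w V1)

/-- Minimum `(A,B)`-cut. -/
def IsMinCut (w : V → V → ℕ) (A B V1 : Finset V) : Prop :=
  IsCut A B V1 ∧ ∀ U : Finset V, IsCut A B U → cutSize w V1 ≤ cutSize w U

/-- MM `(A,B)`-cut: minimum cut with `|V1|` maximum among minimum cuts. -/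
def IsMMCut (w : V → V → ℕ) (A B V1 : Finset V) : Prop :=
  IsMinCut w A B V1 ∧ ∀ U : Finset V, IsMinCut w A B U → U.card ≤ V1.card

/-- Important `(A,B)`-cut. -/
def IsImportantCut (w : V → V → ℕ) (A B V1 : Finset V) : Prop :=
  IsMinimalCut w A B V1 ∧
  ¬ ∃ X' : Finset V, IsCut A B X' ∧ V1 ⊂ X' ∧ cutSize w X' ≤ cutSize w V1

/-- Degree of a vertex. -/
def deg (w : V → V → ℕ) (v : V) : ℕ := ∑ u, w v u

/-- `deg(v; X)`: degree of `v` towards `X ∖ {v}`. -/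
def degIn (w : V → V → ℕ) (v : V) (X : Finset V) : ℕ :=
  ∑ u ∈ X.erase v, w v u

/-- Neighborhood `N(X)`. -/
def nbhd (w : V → V → ℕ) (X : Finset V) : Finset V :=
  Finset.univ.filter (fun u => u ∉ X ∧ ∃ x ∈ X, 0 < w u x)

/-- Feasible `(A,B)`-cut for the bounded-degree cut instance `(G,A,B,uA,uB,k)`. -/
def FeasibleCut (w : V → V → ℕ) (uA uB : V → ℕ) (k : ℕ) (A B VA : Finset V) : Prop :=
  IsMinimalCut w A B VA ∧ cutSize w VA ≤ k ∧
  (∀ v ∈ VA, degIn w v VA ≤ uA v) ∧ (∀ v ∈ VAᶜ, degIn w v VAᶜ ≤ uB v)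

/-- Feasibility of the instance `(G,A,B,uA,uB,k)`. -/
def Feasible (w : V → V → ℕ) (uA uB : V → ℕ) (k : ℕ) (A B : Finset V) : Prop :=
  ∃ VA : Finset V, FeasibleCut w uA uB k A B VA

/-- Unsatisfied vertices w.r.t. an upper-bound function `u` : `{v : deg(v) > u v}`. -/
def unsat (w : V → V → ℕ) (u : V → ℕ) : Finset V :=
  Finset.univ.filter (fun v => u v < deg w v)

/-- Easy instance. -/
def EasyInstance (w : V → V → ℕ) (uA uB : V → ℕ) (A B : Finset V) : Prop :=
  unsat w uA ∪ unsat w uB ⊆ A ∪ B ∧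
  nbhd w (unsat w uA ∩ A) ⊆ A ∪ B ∧
  nbhd w (unsat w uB ∩ B) ⊆ A ∪ B

/-- `A_π` for the cut `π = (V1, V1ᶜ)`. -/
def Api (w : V → V → ℕ) (uA uB : V → ℕ) (A V1 : Finset V) : Finset V :=
  A ∪ (unsat w uA ∩ V1) ∪ (unsat w uB ∩ V1) ∪
    (nbhd w (unsat w uA ∩ V1) ∩ V1) ∪ (nbhd w (unsat w uB ∩ V1ᶜ) ∩ V1)

/-- `B_π` for the cut `π = (V1, V1ᶜ)`. -/
def Bpi (w : V → V → ℕ) (uA uB : V → ℕ) (B V1 : Finset V) : Finset V :=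
  B ∪ (unsat w uA ∩ V1ᶜ) ∪ (unsat w uB ∩ V1ᶜ) ∪
    (nbhd w (unsat w uA ∩ V1) ∩ V1ᶜ) ∪ (nbhd w (unsat w uB ∩ V1ᶜ) ∩ V1ᶜ)

lemma cutSize_eq_univ (w : V → V → ℕ) (X : Finset V) :
    cutSize w X = ∑ u, ∑ v, if u ∈ X ∧ v ∉ X then w u v else 0 := by
  unfold cutSize
  rw [← Finset.sum_filter_add_sum_filter_not univ (fun u => u ∈ X)]
  have h2 : ∑ u ∈ univ.filter (fun u => ¬ u ∈ X),
      ∑ v, (if u ∈ X ∧ v ∉ X then w u v else 0) = 0 := by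
    apply Finset.sum_eq_zero
    intro u hu
    have : u ∉ X := by simpa using hu
    simp [this]
  rw [h2, add_zero]
  have h1 : univ.filter (fun u => u ∈ X) = X := by ext; simp
  rw [h1]
  apply Finset.sum_congr rfl
  intro u hu
  have h3 : Xᶜ = univ.filter (fun v => v ∉ X) := by ext; simp
  rw [h3, Finset.sum_filter]
  simp [hu]

lemma cutSize_submod (w : V → V → ℕ) (X Y : Finset V) :
    cutSize w (X ∩ Y) + cutSize w (X ∪ Y) ≤ cutSize w X + cutSize w Y := by
  simp only [cutSize_eq_univ, ← Finset.sum_add_distrib]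
  apply Finset.sum_le_sum
  intro u _
  apply Finset.sum_le_sum
  intro v _
  by_cases h1 : u ∈ X <;> by_cases h2 : u ∈ Y <;> by_cases h3 : v ∈ X <;>
    by_cases h4 : v ∈ Y <;> simp [h1, h2, h3, h4]

/-- Every vertex of `X` is reachable from `A` inside `X`. -/
def ReachIn (w : V → V → ℕ) (A X : Finset V) : Prop :=
  ∀ Y : Finset V, A ⊆ Y → Y ⊂ X → ∃ u ∈ Y, ∃ v ∈ X, v ∉ Y ∧ 0 < w u v

/-- Remove one copy of the arc `(a,b)`. -/
def decArc (w : V → V → ℕ) (a b : V) : V → V → ℕ :=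
  fun x y => if x = a ∧ y = b then w x y - 1 else w x y

lemma cutSize_add_arc (w : V → V → ℕ) (a b : V) (X : Finset V) (ha : a ∈ X) (hb : b ∉ X) :
    cutSize (fun x y => w x y + if x = a ∧ y = b then 1 else 0) X = cutSize w X + 1 := by
  unfold cutSize
  simp only [Finset.sum_add_distrib]
  congr 1
  rw [Finset.sum_eq_single_of_mem a ha, Finset.sum_eq_single_of_mem b (by simpa using hb)]
  · simp
  · intro c _ hc
    simp [hc]
  · intro c _ hc
    simp [hc]

lemma cutSize_decArc (w : V → V → ℕ) (a b : V) (X : Finset V) (ha : a ∈ X) (hb : b ∉ X)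
    (hw : 0 < w a b) : cutSize w X = cutSize (decArc w a b) X + 1 := by
  rw [← cutSize_add_arc _ a b X ha hb]
  congr 1
  funext x y
  unfold decArc
  by_cases h : x = a ∧ y = b
  · obtain ⟨rfl, rfl⟩ := h
    simp
    omega
  · simp [h]

lemma pushed_family (n : ℕ) : ∀ (w : V → V → ℕ) (A B : Finset V) (p l : ℕ),
    (∀ X, IsCut A B X → l ≤ cutSize w X) → 2 * p ≤ l + n →
    ∃ F : Finset (Finset V), F.card ≤ 2 ^ n ∧
      (∀ S ∈ F, IsCut A B S ∧ cutSize w S ≤ p) ∧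
      ∀ X, IsCut A B X → cutSize w X ≤ p → ReachIn w A X → ∃ S ∈ F, X ⊆ S := by
  induction n with
  | zero => ?_
  | succ m ih => ?_
  all_goals
    intro w A B p l hl hp
    by_cases hex : ∃ X, IsCut A B X ∧ cutSize w X ≤ p
    swap
    · refine ⟨∅, by simp, by simp, ?_⟩
      intro X hX hc
      exact absurd ⟨X, hX, hc⟩ hex
    obtain ⟨X0, hX0, hX0p⟩ := hex
    obtain ⟨M1, hM1, hM1min⟩ := Finset.exists_min_image
      ((univ : Finset (Finset V)).filter (fun X => A ⊆ X ∧ B ⊆ Xᶜ)) (cutSize w)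
      ⟨X0, by simpa [IsCut] using hX0⟩
    obtain ⟨M, hM, hMmax⟩ := Finset.exists_max_image
      ((univ : Finset (Finset V)).filter
        (fun X => (A ⊆ X ∧ B ⊆ Xᶜ) ∧ cutSize w X = cutSize w M1)) Finset.card
      ⟨M1, by simpa using hM1⟩
    simp only [mem_filter, mem_univ, true_and] at hM1 hM1min hM hMmax
    obtain ⟨hMcut, hMeq⟩ := hM
    rw [← hMeq] at hM1min hMmax
    have hMp : cutSize w M ≤ p := (hM1min X0 hX0).trans hX0p
    have hlM := hl M hMcut
    have push : ∀ X, IsCut A B X → cutSize w X ≤ p → ReachIn w A X →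
        IsCut M B (X ∪ M) ∧ cutSize w (X ∪ M) ≤ p ∧ ReachIn w M (X ∪ M) := by
      intro X hX hXp hR
      have hi : IsCut A B (X ∩ M) := by
        refine ⟨Finset.subset_inter hX.1 hMcut.1, ?_⟩
        intro b hb
        have := hX.2 hb
        simp at this ⊢
        tauto
      have h1 := hM1min _ hi
      have h2 := cutSize_submod w X M
      refine ⟨⟨Finset.subset_union_right, ?_⟩, by omega, ?_⟩
      · intro b hb
        have h3 := hX.2 hb
        have h4 := hMcut.2 hb
        simp at h3 h4 ⊢
        tauto
      · intro Y hMY hYX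
        obtain ⟨hsub, x, hx, hxY⟩ := Finset.ssubset_iff_exists_subset_erase.mp hYX |> fun _ =>
          (⟨hYX.1, Finset.not_subset.mp hYX.2⟩ : Y ⊆ X ∪ M ∧ ∃ x ∈ X ∪ M, x ∉ Y)
        have hxX : x ∈ X := by
          rcases Finset.mem_union.mp hx with h | h
          · exact h
          · exact absurd (hMY h) hxY
        obtain ⟨u, hu, v, hv, hvY, huv⟩ := hR (Y ∩ X)
          (Finset.subset_inter (hMcut.1.trans hMY) hX.1)
          ⟨Finset.inter_subset_right, fun h => hxY (Finset.mem_inter.mp (h hxX)).1⟩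
        refine ⟨u, (Finset.mem_inter.mp hu).1, v, Finset.mem_union_left _ hv, ?_, huv⟩
        intro h
        exact hvY (Finset.mem_inter.mpr ⟨h, hv⟩)
    by_cases h0 : ¬ ∃ u ∈ M, ∃ v, v ∉ M ∧ 0 < w u v
    · refine ⟨{M}, by simp [Nat.one_le_two_pow], ?_, ?_⟩
      · intro S hS
        rw [Finset.mem_singleton] at hS
        subst hS
        exact ⟨hMcut, hMp⟩
      · intro X hX hXp hR
        obtain ⟨h1, h2, h3⟩ := push X hX hXp hR
        refine ⟨M, by simp, ?_⟩
        by_contra hne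
        obtain ⟨u, hu, v, hv, hvM, huv⟩ := h3 M subset_rfl
          ⟨Finset.subset_union_right, fun h => hne (Finset.subset_union_left.trans h)⟩
        exact h0 ⟨u, hu, v, hvM, huv⟩
    push Not at h0
    obtain ⟨u, hu, v, hv, huv⟩ := h0
    have hpos : 0 < cutSize w M := by
      have := cutSize_decArc w u v M hu hv huv
      omega
  · omega
  · obtain ⟨F1, hF1c, hF1, hF1'⟩ := ih w (insert v M) B p (cutSize w M + 1) (by
      intro X hX
      have hXc : IsCut A B X :=
        ⟨hMcut.1.trans ((Finset.subset_insert v M).trans hX.1), hX.2⟩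
      have h1 := hM1min X hXc
      by_contra hlt
      have h2 := hMmax X ⟨hXc, by omega⟩
      have h3 := Finset.card_le_card hX.1
      rw [Finset.card_insert_of_notMem hv] at h3
      omega) (by omega)
    obtain ⟨F2, hF2c, hF2, hF2'⟩ := ih (decArc w u v) M (insert v B) (p - 1) (cutSize w M - 1) (by
      intro X hX
      have hvX : v ∉ X := by
        have := hX.2 (Finset.mem_insert_self v B)
        simpa using this
      have h1 := hM1min X ⟨hMcut.1.trans hX.1, (Finset.subset_insert v B).trans hX.2⟩
      have h2 := cutSize_decArc w u v X (hX.1 hu) hvX huv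
      omega) (by omega)
    refine ⟨F1 ∪ F2, ?_, ?_, ?_⟩
    · have := Finset.card_union_le F1 F2
      rw [pow_succ]
      omega
    · intro S hS
      rcases Finset.mem_union.mp hS with h | h
      · obtain ⟨h1, h2⟩ := hF1 S h
        exact ⟨⟨hMcut.1.trans ((Finset.subset_insert v M).trans h1.1), h1.2⟩, h2⟩
      · obtain ⟨h1, h2⟩ := hF2 S h
        have hvS : v ∉ S := by
          have := h1.2 (Finset.mem_insert_self v B)
          simpa using this
        have h3 := cutSize_decArc w u v S (h1.1 hu) hvS huv
        exact ⟨⟨hMcut.1.trans h1.1, (Finset.subset_insert v B).trans h1.2⟩, by omega⟩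
    · intro X hX hXp hR
      obtain ⟨h1, h2, h3⟩ := push X hX hXp hR
      by_cases hvX : v ∈ X ∪ M
      · obtain ⟨S, hS, hXS⟩ := hF1' (X ∪ M) ⟨Finset.insert_subset hvX h1.1, h1.2⟩ h2
          (fun Y hY hYX => h3 Y ((Finset.subset_insert v M).trans hY) hYX)
        exact ⟨S, Finset.mem_union_left _ hS, Finset.subset_union_left.trans hXS⟩
      · have h4 := cutSize_decArc w u v (X ∪ M) (h1.1 hu) hvX huv
        obtain ⟨S, hS, hXS⟩ := hF2' (X ∪ M)
          ⟨h1.1, Finset.insert_subset (by simpa using hvX) h1.2⟩ (by omega) (by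
            intro Y hY hYX
            obtain ⟨a, ha, b, hb, hbY, hab⟩ := h3 Y hY hYX
            refine ⟨a, ha, b, hb, hbY, ?_⟩
            have hbv : b ≠ v := fun h => hvX (h ▸ hb)
            simpa [decArc, hbv] using hab)
        exact ⟨S, Finset.mem_union_right _ hS, Finset.subset_union_left.trans hXS⟩

lemma cutSize_add_sink (w : V → V → ℕ) (Z X : Finset V) (b : V) (hb : b ∉ X) :
    cutSize (fun x y => w x y + if x ∈ Z ∧ y = b then 1 else 0) X
      = cutSize w X + (Z ∩ X).card := by
  unfold cutSize
  simp only [Finset.sum_add_distrib]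
  congr 1
  have : ∀ x ∈ X, (∑ y ∈ Xᶜ, if x ∈ Z ∧ y = b then 1 else 0) = if x ∈ Z then 1 else 0 := by
    intro x _
    rw [Finset.sum_eq_single_of_mem b (by simpa using hb)]
    · simp
    · intro c _ hc
      simp [hc]
  rw [Finset.sum_congr rfl this, ← Finset.card_filter]
  congr 1
  ext x
  simp [and_comm]

lemma card_unsat_inter_le (w : V → V → ℕ) (hloop : ∀ v, w v v = 0) (u : V → ℕ) (X : Finset V)
    (hdeg : ∀ v ∈ X, degIn w v X ≤ u v) : (unsat w u ∩ X).card ≤ cutSize w X := by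
  unfold cutSize
  rw [Finset.card_eq_sum_ones]
  refine le_trans ?_ (Finset.sum_le_sum_of_subset (Finset.inter_subset_right (s₁ := unsat w u)))
  apply Finset.sum_le_sum
  intro v hv
  obtain ⟨hvZ, hvX⟩ := Finset.mem_inter.mp hv
  have h1 : u v < deg w v := by simpa [unsat] using hvZ
  have h2 := hdeg v hvX
  have h3 : degIn w v X = ∑ y ∈ X, w v y := by
    unfold degIn
    rw [← Finset.add_sum_erase X (fun y => w v y) hvX, hloop, zero_add]
  have h4 : deg w v = ∑ y ∈ X, w v y + ∑ y ∈ Xᶜ, w v y :=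
    (Finset.sum_add_sum_compl X _).symm
  omega

lemma one_side (w : V → V → ℕ) (hloop : ∀ v, w v v = 0) (A B : Finset V) (hB : B.Nonempty)
    (u : V → ℕ) (k : ℕ) :
    ∃ Q : Finset (Finset V), Q.card ≤ 2 ^ (6 * k) ∧
      ∀ X, IsCut A B X → cutSize w X ≤ k → ReachIn w A X →
        (∀ v ∈ X, degIn w v X ≤ u v) → unsat w u ∩ X ∈ Q := by
  obtain ⟨b, hb⟩ := hB
  have hbX : ∀ X, IsCut A B X → b ∉ X := by
    intro X hX
    have := hX.2 hb
    simpa using this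
  obtain ⟨F, hFc, hF, hF'⟩ := pushed_family (4 * k)
    (fun x y => w x y + if x ∈ unsat w u ∧ y = b then 1 else 0) A B (2 * k) 0
    (fun _ _ => Nat.zero_le _) (by omega)
  refine ⟨F.biUnion (fun S => (unsat w u ∩ S).powerset), ?_, ?_⟩
  · refine (Finset.card_biUnion_le_card_mul F _ (2 ^ (2 * k)) ?_).trans ?_
    · intro S hS
      obtain ⟨h1, h2⟩ := hF S hS
      rw [cutSize_add_sink w _ S b (hbX S h1)] at h2
      rw [Finset.card_powerset]
      exact Nat.pow_le_pow_right (by norm_num) (by omega)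
    · calc F.card * 2 ^ (2 * k) ≤ 2 ^ (4 * k) * 2 ^ (2 * k) := Nat.mul_le_mul_right _ hFc
        _ = 2 ^ (6 * k) := by rw [← pow_add]; congr 1; omega
  · intro X hX hXk hR hdeg
    have h1 := card_unsat_inter_le w hloop u X hdeg
    obtain ⟨S, hS, hXS⟩ := hF' X hX (by rw [cutSize_add_sink w _ X b (hbX X hX)]; omega) (by
      intro Y hY hYX
      obtain ⟨a, ha, c, hc, hcY, hac⟩ := hR Y hY hYX
      exact ⟨a, ha, c, hc, hcY, by dsimp only; omega⟩)
    rw [Finset.mem_biUnion]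
    refine ⟨S, hS, ?_⟩
    rw [Finset.mem_powerset]
    exact Finset.inter_subset_inter_left hXS

lemma reachIn_of_minimal (w : V → V → ℕ) (A X : Finset V)
    (h : ¬ ∃ Y : Finset V, A ⊆ Y ∧ Y ⊂ X ∧ bdry w Y ⊆ bdry w X) : ReachIn w A X := by
  intro Y hAY hYX
  by_contra hno
  refine h ⟨Y, hAY, hYX, ?_⟩
  rintro e ⟨a, c, rfl, ha, hc, hac⟩
  exact ⟨a, c, rfl, hYX.1 ha, fun hcX => hno ⟨a, ha, c, hcX, hc, hac⟩, hac⟩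

lemma bdry_compl (w : V → V → ℕ) (hsymm : ∀ u v, w u v = w v u) (X : Finset V) :
    bdry w X ⊆ bdry w Xᶜ := by
  rintro e ⟨a, c, rfl, ha, hc, hac⟩
  exact ⟨c, a, Sym2.eq_swap, by simpa using hc, by simpa using ha, by rw [hsymm]; exact hac⟩

lemma cutSize_compl (w : V → V → ℕ) (hsymm : ∀ u v, w u v = w v u) (X : Finset V) :
    cutSize w Xᶜ = cutSize w X := by
  unfold cutSize
  rw [Finset.sum_comm, compl_compl]
  exact Finset.sum_congr rfl fun a _ => Finset.sum_congr rfl fun c _ => hsymm c a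

/-- a family of at most `2^{12k}` candidate pairs for `(Z_A ∩ V1, Z_B ∩ V2)`
over feasible `(A,B)`-cuts. -/
theorem candidate_pairs_unsat (w : V → V → ℕ)
    (hsymm : ∀ u v, w u v = w v u) (hloop : ∀ v, w v v = 0)
    (A B : Finset V) (uA uB : V → ℕ) (k : ℕ)
    (hA : A.Nonempty) (hB : B.Nonempty) (hAB : Disjoint A B) :
    ∃ P : Finset (Finset V × Finset V), P.card ≤ 2 ^ (12 * k) ∧
      (∀ p ∈ P, Disjoint p.1 p.2 ∧ p.1 ⊆ unsat w uA ∧ p.2 ⊆ unsat w uB) ∧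
      ∀ V1 : Finset V, FeasibleCut w uA uB k A B V1 →
        (unsat w uA ∩ V1, unsat w uB ∩ V1ᶜ) ∈ P := by
  obtain ⟨QA, hQA, hQA'⟩ := one_side w hloop A B hB uA k
  obtain ⟨QB, hQB, hQB'⟩ := one_side w hloop B A hA uB k
  refine ⟨(QA ×ˢ QB).filter
    (fun p => Disjoint p.1 p.2 ∧ p.1 ⊆ unsat w uA ∧ p.2 ⊆ unsat w uB), ?_, ?_, ?_⟩
  · refine (Finset.card_filter_le _ _).trans ?_
    rw [Finset.card_product]
    calc QA.card * QB.card ≤ 2 ^ (6 * k) * 2 ^ (6 * k) := Nat.mul_le_mul hQA hQB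
      _ = 2 ^ (12 * k) := by rw [← pow_add]; congr 1; omega
  · intro p hp
    exact (Finset.mem_filter.mp hp).2
  · rintro V1 ⟨⟨hcut, hmin1, hmin2⟩, hk, hdA, hdB⟩
    rw [Finset.mem_filter, Finset.mem_product]
    refine ⟨⟨?_, ?_⟩, ?_, Finset.inter_subset_left, Finset.inter_subset_left⟩
    · exact hQA' V1 hcut hk (reachIn_of_minimal w A V1 hmin1) hdA
    · refine hQB' V1ᶜ ⟨hcut.2, by rw [compl_compl]; exact hcut.1⟩
        (by rw [cutSize_compl w hsymm]; exact hk) (reachIn_of_minimal w B V1ᶜ ?_) hdB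
      rintro ⟨Y, h1, h2, h3⟩
      refine hmin2 ⟨Y, h1, h2, h3.trans ?_⟩
      have := bdry_compl w hsymm V1ᶜ
      rwa [compl_compl] at this
    · exact (disjoint_compl_right (a := V1)).mono Finset.inter_subset_right
        Finset.inter_subset_right
end

section
/- Let I = (G, A, B, u_A, u_B, k) be an instance of bounded-degree cut. Then there exists a family ℱ of at most 2^{18k} pairs (A', B') of disjoint subsets of V with A ⊆ A' and B ⊆ B', such that each instance (G, A', B', u_A, u_B, k) with (A', B') ∈ ℱ is an easy instance, and for every feasible (A,B)-cut π = (V1, V2) of I the pair (A_π, B_π) belongs to ℱ; consequently, I is feasible if and only if there exists (A', B') ∈ ℱ such that the instance (G, A', B', u_A, u_B, k) is feasible. -/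
open Finset

variable {V : Type*} [Fintype V] [DecidableEq V]

theorem cs_eq (w : V → V → ℕ) (S : Finset V) :
    cutSize w S = ∑ u, ∑ v, if u ∈ S ∧ v ∉ S then w u v else 0 := by
  unfold cutSize
  rw [← Finset.sum_filter_add_sum_filter_not univ (· ∈ S)]
  have h2 : ∑ u ∈ univ.filter (fun u => ¬ u ∈ S),
      ∑ v, (if u ∈ S ∧ v ∉ S then w u v else 0) = 0 := by
    apply Finset.sum_eq_zero
    intro u hu
    apply Finset.sum_eq_zero
    intro v _
    simp at hu
    simp [hu]
  rw [h2, add_zero]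
  have h3 : univ.filter (· ∈ S) = S := by ext; simp
  rw [h3]
  apply Finset.sum_congr rfl
  intro u hu
  have h4 : Sᶜ = univ.filter (fun v => v ∉ S) := by ext; simp
  rw [h4, Finset.sum_filter]
  simp [hu]

theorem cs_submod (w : V → V → ℕ) (S T : Finset V) :
    cutSize w (S ∪ T) + cutSize w (S ∩ T) ≤ cutSize w S + cutSize w T := by
  simp only [cs_eq, ← Finset.sum_add_distrib]
  apply Finset.sum_le_sum
  intro u _
  apply Finset.sum_le_sum
  intro v _
  by_cases h1 : u ∈ S <;> by_cases h2 : u ∈ T <;> by_cases h3 : v ∈ S <;>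
    by_cases h4 : v ∈ T <;> simp [h1, h2, h3, h4]

/-- Every vertex of `S` is reachable from `A` inside `S`. -/
def Conn (w : V → V → ℕ) (A S : Finset V) : Prop :=
  ∀ U : Finset V, A ⊆ U → U ⊂ S → ∃ u ∈ U, ∃ v ∈ S, v ∉ U ∧ 0 < w u v

theorem Conn.union {w : V → V → ℕ} {A R S : Finset V} (h : Conn w A S) (hAS : A ⊆ S)
    (hAR : A ⊆ R) : Conn w R (S ∪ R) := by
  intro U hRU hU
  have hns : ¬ S ⊆ U := fun hs => hU.2 (Finset.union_subset hs hRU)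
  obtain ⟨u, hu, v, hv, hvU, hw⟩ := h (U ∩ S)
    (Finset.subset_inter (hAR.trans hRU) hAS)
    ⟨Finset.inter_subset_right, fun hs => hns (hs.trans Finset.inter_subset_left)⟩
  exact ⟨u, (Finset.mem_inter.1 hu).1, v, Finset.mem_union_left _ hv,
    fun h' => hvU (Finset.mem_inter.2 ⟨h', hv⟩), hw⟩

/-- Remove one copy of the arc `(x,y)`. -/
def del (w : V → V → ℕ) (x y : V) : V → V → ℕ :=
  fun u v => if u = x ∧ v = y then w u v - 1 else w u v

theorem ind_sum (x y : V) : (∑ u, ∑ v, if u = x ∧ v = y then 1 else 0) = 1 := by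
  simp [ite_and]

theorem cs_del_le (w : V → V → ℕ) (x y : V) (S : Finset V) :
    cutSize w S ≤ cutSize (del w x y) S + 1 := by
  rw [← ind_sum x y]
  simp only [cs_eq, ← Finset.sum_add_distrib]
  apply Finset.sum_le_sum
  intro u _
  apply Finset.sum_le_sum
  intro v _
  unfold del
  split_ifs <;> omega

theorem cs_del_eq (w : V → V → ℕ) (x y : V) (S : Finset V) (hx : x ∈ S) (hy : y ∉ S)
    (hw : 0 < w x y) : cutSize (del w x y) S + 1 = cutSize w S := by
  rw [← ind_sum x y]
  simp only [cs_eq, ← Finset.sum_add_distrib]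
  apply Finset.sum_congr rfl
  intro u _
  apply Finset.sum_congr rfl
  intro v _
  unfold del
  by_cases h : u = x ∧ v = y
  · obtain ⟨rfl, rfl⟩ := h
    simp [hx, hy]
    omega
  · simp [h]

theorem exists_edge (w : V → V → ℕ) (S : Finset V) (h : cutSize w S ≠ 0) :
    ∃ x ∈ S, ∃ y, y ∉ S ∧ 0 < w x y := by
  by_contra hc
  push Not at hc
  apply h
  unfold cutSize
  apply Finset.sum_eq_zero
  intro u hu
  apply Finset.sum_eq_zero
  intro v hv
  have := hc u hu v (by simpa using hv)
  omega

theorem edge_le (w : V → V → ℕ) (S : Finset V) (x y : V) (hx : x ∈ S) (hy : y ∉ S) :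
    w x y ≤ cutSize w S := by
  unfold cutSize
  calc w x y ≤ ∑ v ∈ Sᶜ, w x v :=
        Finset.single_le_sum (f := fun v => w x v) (fun _ _ => Nat.zero_le _) (by simpa using hy)
    _ ≤ _ := Finset.single_le_sum (f := fun u => ∑ v ∈ Sᶜ, w u v)
        (fun _ _ => Nat.zero_le _) hx

theorem exists_max_min (w : V → V → ℕ) (A B : Finset V) (hAB : Disjoint A B) :
    ∃ R : Finset V, A ⊆ R ∧ Disjoint R B ∧
      (∀ S, A ⊆ S → Disjoint S B → cutSize w R ≤ cutSize w S) ∧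
      (∀ S, R ⊂ S → Disjoint S B → cutSize w R < cutSize w S) := by
  classical
  obtain ⟨R0, h0, hm0⟩ := Finset.exists_min_image
    (univ.filter (fun S : Finset V => A ⊆ S ∧ Disjoint S B)) (cutSize w)
    ⟨A, by simp [hAB]⟩
  obtain ⟨R, h1, hm1⟩ := Finset.exists_max_image
    (univ.filter (fun S : Finset V => A ⊆ S ∧ Disjoint S B ∧ cutSize w S ≤ cutSize w R0))
    Finset.card ⟨R0, by simpa using h0⟩
  simp only [Finset.mem_filter, Finset.mem_univ, true_and] at h0 hm0 h1 hm1
  refine ⟨R, h1.1, h1.2.1, fun S hS hd => h1.2.2.trans (hm0 S ⟨hS, hd⟩), ?_⟩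
  intro S hS hd
  by_contra hc
  have := hm1 S ⟨h1.1.trans hS.1, hd, (not_lt.1 hc).trans h1.2.2⟩
  have := Finset.card_lt_card hS
  omega

theorem cover (n : ℕ) : ∀ (w : V → V → ℕ) (A B : Finset V) (m L : ℕ),
    (∀ S, A ⊆ S → Disjoint S B → L ≤ cutSize w S) → 2 * m ≤ n + L →
    ∃ F : Finset (Finset V), F.card ≤ 2 ^ n ∧
      (∀ S ∈ F, Disjoint S B ∧ cutSize w S ≤ m) ∧
      (∀ S, A ⊆ S → Disjoint S B → Conn w A S → cutSize w S ≤ m → ∃ T ∈ F, S ⊆ T) := by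
  classical
  induction n with
  | zero =>
    intro w A B m L hL hm
    by_cases hex : ∃ S, A ⊆ S ∧ Disjoint S B ∧ cutSize w S ≤ m
    swap
    · exact ⟨∅, by simp, by simp, fun S h1 h2 _ h3 => (hex ⟨S, h1, h2, h3⟩).elim⟩
    obtain ⟨S0, hS0, hd0, hc0⟩ := hex
    obtain ⟨R, hAR, hRB, hmin, -⟩ := exists_max_min w A B (hd0.mono_left hS0)
    have h1 := hmin S0 hS0 hd0
    have h2 := hL R hAR hRB
    have hR : cutSize w R = 0 := by omega
    refine ⟨{R}, by simp, by simp [hRB]; omega, ?_⟩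
    intro S hAS hSB hconn hSm
    refine ⟨R, by simp, ?_⟩
    by_contra hns
    obtain ⟨u, hu, v, -, hv, hw⟩ := hconn.union hAS hAR R subset_rfl
      ⟨Finset.subset_union_right, fun h => hns (Finset.subset_union_left.trans h)⟩
    have := edge_le w R u v hu hv
    omega
  | succ n ih =>
    intro w A B m L hL hm
    by_cases hex : ∃ S, A ⊆ S ∧ Disjoint S B ∧ cutSize w S ≤ m
    swap
    · exact ⟨∅, by simp, by simp, fun S h1 h2 _ h3 => (hex ⟨S, h1, h2, h3⟩).elim⟩
    obtain ⟨S0, hS0, hd0, hc0⟩ := hex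
    obtain ⟨R, hAR, hRB, hmin, hmax⟩ := exists_max_min w A B (hd0.mono_left hS0)
    have h1 := hmin S0 hS0 hd0
    have h2 := hL R hAR hRB
    by_cases hR : cutSize w R = 0
    · refine ⟨{R}, by simpa using Nat.one_le_two_pow, by simp [hRB]; omega, ?_⟩
      intro S hAS hSB hconn hSm
      refine ⟨R, by simp, ?_⟩
      by_contra hns
      obtain ⟨u, hu, v, -, hv, hw⟩ := hconn.union hAS hAR R subset_rfl
        ⟨Finset.subset_union_right, fun h => hns (Finset.subset_union_left.trans h)⟩
      have := edge_le w R u v hu hv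
      omega
    obtain ⟨x, hx, y, hy, hxy⟩ := exists_edge w R hR
    obtain ⟨F1, hF1, hF1', hF1''⟩ := ih w (insert y R) B m (cutSize w R + 1)
      (fun S hS hSB => hmax S ⟨(Finset.subset_insert _ _).trans hS,
        fun h => hy (h (hS (Finset.mem_insert_self _ _)))⟩ hSB) (by omega)
    obtain ⟨F2, hF2, hF2', hF2''⟩ := ih (del w x y) R B (m - 1) (cutSize w R - 1)
      (fun S hS hSB => by
        have := hmin S (hAR.trans hS) hSB
        have := cs_del_le w x y S
        omega) (by omega)
    refine ⟨F1 ∪ F2, ?_, ?_, ?_⟩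
    · have := Finset.card_union_le F1 F2
      rw [pow_succ]
      omega
    · intro S hS
      rcases Finset.mem_union.1 hS with hS | hS
      · exact hF1' S hS
      · have := hF2' S hS
        refine ⟨this.1, ?_⟩
        have := cs_del_le w x y S
        omega
    · intro S hAS hSB hconn hSm
      have hsub := cs_submod w S R
      have hi := hmin (S ∩ R) (Finset.subset_inter hAS hAR)
        (hSB.mono_left Finset.inter_subset_left)
      have hUB : Disjoint (S ∪ R) B := Finset.disjoint_union_left.2 ⟨hSB, hRB⟩
      have hUc := hconn.union hAS hAR
      have hUm : cutSize w (S ∪ R) ≤ m := by omega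
      by_cases hyS : y ∈ S ∪ R
      · obtain ⟨T, hT, hST⟩ := hF1'' (S ∪ R)
          (Finset.insert_subset hyS Finset.subset_union_right) hUB
          (fun U hU hUS => hUc U ((Finset.subset_insert _ _).trans hU) hUS) hUm
        exact ⟨T, Finset.mem_union_left _ hT, Finset.subset_union_left.trans hST⟩
      · have hxS : x ∈ S ∪ R := Finset.mem_union_right _ hx
        have hde := cs_del_eq w x y (S ∪ R) hxS hyS hxy
        obtain ⟨T, hT, hST⟩ := hF2'' (S ∪ R) Finset.subset_union_right hUB
          (fun U hU hUS => by
            obtain ⟨u, hu, v, hv, hvU, hw⟩ := hUc U hU hUS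
            refine ⟨u, hu, v, hv, hvU, ?_⟩
            have : v ≠ y := fun h => hyS (h ▸ hv)
            simpa [del, this] using hw) (by omega)
        exact ⟨T, Finset.mem_union_right _ hT, Finset.subset_union_left.trans hST⟩

theorem cs_add (w : V → V → ℕ) (X S : Finset V) (b : V) (hb : b ∉ S) :
    cutSize (fun u v => w u v + if u ∈ X ∧ v = b then 1 else 0) S
      = cutSize w S + (X ∩ S).card := by
  unfold cutSize
  simp only [Finset.sum_add_distrib]
  congr 1
  rw [Finset.inter_comm, ← Finset.filter_mem_eq_inter, Finset.card_filter]
  apply Finset.sum_congr rfl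
  intro u _
  by_cases h : u ∈ X <;> simp [h, hb]

theorem traces (w : V → V → ℕ) (A B X : Finset V) (k : ℕ) (hB : B.Nonempty) :
    ∃ F : Finset (Finset V), F.card ≤ 2 ^ (6 * k) ∧
      ∀ S, A ⊆ S → Disjoint S B → Conn w A S → cutSize w S ≤ k →
        (∀ u ∈ X ∩ S, ∃ v, v ∉ S ∧ 0 < w u v) → X ∩ S ∈ F := by
  classical
  obtain ⟨b, hb⟩ := hB
  obtain ⟨F, hF, hF', hF''⟩ := cover (4 * k)
    (fun u v => w u v + if u ∈ X ∧ v = b then 1 else 0) A B (2 * k) 0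
    (fun _ _ _ => Nat.zero_le _) (by omega)
  refine ⟨F.biUnion (fun S => (X ∩ S).powerset), ?_, ?_⟩
  · calc _ ≤ F.card * 2 ^ (2 * k) := by
          apply Finset.card_biUnion_le_card_mul
          intro S hS
          rw [Finset.card_powerset]
          apply Nat.pow_le_pow_right (by norm_num)
          obtain ⟨h1, h2⟩ := hF' S hS
          rw [cs_add w X S b (fun h => Finset.disjoint_left.1 h1 h hb)] at h2
          omega
      _ ≤ 2 ^ (4 * k) * 2 ^ (2 * k) := Nat.mul_le_mul_right _ hF
      _ = 2 ^ (6 * k) := by rw [← pow_add]; congr 1; omega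
  · intro S hAS hSB hconn hSk hX
    have hcard : (X ∩ S).card ≤ k := by
      refine le_trans ?_ hSk
      unfold cutSize
      calc (X ∩ S).card = ∑ u ∈ X ∩ S, 1 := by simp
        _ ≤ ∑ u ∈ X ∩ S, ∑ v ∈ Sᶜ, w u v := by
            apply Finset.sum_le_sum
            intro u hu
            obtain ⟨v, hv, hw⟩ := hX u hu
            exact le_trans hw (Finset.single_le_sum (f := fun v => w u v)
              (fun _ _ => Nat.zero_le _) (by simpa using hv))
        _ ≤ _ := Finset.sum_le_sum_of_subset Finset.inter_subset_right
    obtain ⟨T, hT, hST⟩ := hF'' S hAS hSB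
      (fun U hU hUS => by
        obtain ⟨u, hu, v, hv, hvU, hw⟩ := hconn U hU hUS
        exact ⟨u, hu, v, hv, hvU, by positivity⟩)
      (by rw [cs_add w X S b (fun h => Finset.disjoint_left.1 hSB h hb)]; omega)
    exact Finset.mem_biUnion.2 ⟨T, hT, Finset.mem_powerset.2
      (Finset.inter_subset_inter subset_rfl hST)⟩

theorem conn_left {w : V → V → ℕ} {A B V1 : Finset V} (h : IsMinimalCut w A B V1) :
    Conn w A V1 := by
  intro U hU hUS
  by_contra hc
  push Not at hc
  refine h.2.1 ⟨U, hU, hUS, ?_⟩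
  rintro e ⟨u, v, rfl, hu, hv, hw⟩
  refine ⟨u, v, rfl, hUS.1 hu, fun hv1 => ?_, hw⟩
  have := hc u hu v hv1 hv
  omega

theorem conn_right {w : V → V → ℕ} (hsymm : ∀ u v, w u v = w v u)
    {A B V1 : Finset V} (h : IsMinimalCut w A B V1) : Conn w B V1ᶜ := by
  intro U hU hUS
  by_contra hc
  push Not at hc
  refine h.2.2 ⟨U, hU, hUS, ?_⟩
  rintro e ⟨u, v, rfl, hu, hv, hw⟩
  have hu1 : u ∉ V1 := by simpa using hUS.1 hu
  refine ⟨v, u, Sym2.eq_swap, ?_, hu1, by rwa [hsymm]⟩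
  by_contra hv1
  have := hc u hu v (by simpa using hv1) hv
  omega

theorem cs_compl {w : V → V → ℕ} (hsymm : ∀ u v, w u v = w v u) (S : Finset V) :
    cutSize w Sᶜ = cutSize w S := by
  unfold cutSize
  rw [Finset.sum_comm, compl_compl]
  exact Finset.sum_congr rfl fun u _ => Finset.sum_congr rfl fun v _ => hsymm _ _

theorem unsat_nb {w : V → V → ℕ} (hloop : ∀ v, w v v = 0) {u : V → ℕ} {S : Finset V} {v : V}
    (hv : v ∈ unsat w u) (hd : degIn w v S ≤ u v) : ∃ x, x ∉ S ∧ 0 < w v x := by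
  by_contra hc
  push Not at hc
  have h1 : u v < deg w v := by simpa [unsat] using hv
  have h2 : deg w v = degIn w v S := by
    unfold deg degIn
    symm
    apply Finset.sum_subset (Finset.subset_univ _)
    intro x _ hx
    by_cases hxv : x = v
    · rw [hxv, hloop]
    · have := hc x (fun h => hx (Finset.mem_erase.2 ⟨hxv, h⟩))
      omega
  omega

theorem feas_mem {w : V → V → ℕ} {uA uB : V → ℕ} {A B V1 : Finset V} (hc : IsCut A B V1) :
    Api w uA uB A V1 ⊆ V1 ∧ Bpi w uA uB B V1 ⊆ V1ᶜ := by
  unfold Api Bpi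
  refine ⟨?_, ?_⟩
  · have := hc.1
    simp [Finset.union_subset_iff, this]
  · have := hc.2
    simp [Finset.union_subset_iff, this]

theorem easy_pi {w : V → V → ℕ} {uA uB : V → ℕ} {A B V1 : Finset V} (hc : IsCut A B V1) :
    EasyInstance w uA uB (Api w uA uB A V1) (Bpi w uA uB B V1) := by
  obtain ⟨hA, hB⟩ := feas_mem (w := w) (uA := uA) (uB := uB) hc
  have e1 : unsat w uA ∩ Api w uA uB A V1 = unsat w uA ∩ V1 := by
    apply Finset.Subset.antisymm (Finset.inter_subset_inter subset_rfl hA)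
    intro v hv
    have := Finset.mem_inter.1 hv
    simp [Api, this.1, this.2]
  have e2 : unsat w uB ∩ Bpi w uA uB B V1 = unsat w uB ∩ V1ᶜ := by
    apply Finset.Subset.antisymm (Finset.inter_subset_inter subset_rfl hB)
    intro v hv
    have := Finset.mem_inter.1 hv
    have h2 := this.2
    simp only [Finset.mem_compl] at h2
    simp [Bpi, this.1, h2]
  refine ⟨?_, ?_, ?_⟩
  · intro v hv
    by_cases h : v ∈ V1 <;> simp [Api, Bpi, h] at hv ⊢ <;> tauto
  · rw [e1]
    intro v hv
    by_cases h : v ∈ V1 <;> simp [Api, Bpi, h, hv]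
  · rw [e2]
    intro v hv
    by_cases h : v ∈ V1 <;> simp [Api, Bpi, h, hv]

theorem feas_pi {w : V → V → ℕ} {uA uB : V → ℕ} {k : ℕ} {A B V1 : Finset V}
    (h : FeasibleCut w uA uB k A B V1) :
    FeasibleCut w uA uB k (Api w uA uB A V1) (Bpi w uA uB B V1) V1 := by
  obtain ⟨⟨hc, h1, h2⟩, h3⟩ := h
  have hAA : A ⊆ Api w uA uB A V1 := by
    intro v hv
    simp [Api, hv]
  have hBB : B ⊆ Bpi w uA uB B V1 := by
    intro v hv
    simp [Bpi, hv]
  exact ⟨⟨feas_mem hc, fun ⟨U, hU, hU'⟩ => h1 ⟨U, hAA.trans hU, hU'⟩,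
    fun ⟨U, hU, hU'⟩ => h2 ⟨U, hBB.trans hU, hU'⟩⟩, h3⟩

/-- Reconstruct `(A_π, B_π)` from the three guessed traces. -/
def recon (w : V → V → ℕ) (uA uB : V → ℕ) (A B P Q R : Finset V) : Finset V × Finset V :=
  (A ∪ (unsat w uA ∩ Q) ∪ (unsat w uB \ P) ∪ (nbhd w (unsat w uA ∩ Q) \ R) ∪ (nbhd w P ∩ Q),
   B ∪ (unsat w uA \ Q) ∪ P ∪ R ∪ (nbhd w P \ Q))

theorem nbhd_ex {w : V → V → ℕ} {X : Finset V} {u : V} (h : u ∈ nbhd w X) :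
    ∃ x ∈ X, 0 < w u x := (Finset.mem_filter.1 h).2.2

theorem recon_eq (w : V → V → ℕ) (uA uB : V → ℕ) (A B V1 P Q R : Finset V)
    (hP : P = unsat w uB ∩ V1ᶜ) (hQ : Q = (unsat w uA ∪ nbhd w P) ∩ V1)
    (hR : R = nbhd w (unsat w uA ∩ Q) ∩ V1ᶜ) :
    (Api w uA uB A V1, Bpi w uA uB B V1) = recon w uA uB A B P Q R := by
  have e : unsat w uA ∩ Q = unsat w uA ∩ V1 := by
    rw [hQ]; ext v; simp; tauto
  unfold recon Api Bpi
  rw [e] at hR ⊢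
  rw [← hP]
  refine Prod.ext ?_ ?_
  · ext v
    have h1 : v ∈ P ↔ v ∈ unsat w uB ∧ v ∉ V1 := by rw [hP]; simp
    have h2 : v ∈ Q ↔ (v ∈ unsat w uA ∨ v ∈ nbhd w P) ∧ v ∈ V1 := by rw [hQ]; simp
    have h3 : v ∈ R ↔ v ∈ nbhd w (unsat w uA ∩ V1) ∧ v ∉ V1 := by rw [hR]; simp
    simp only [Finset.mem_union, Finset.mem_inter, Finset.mem_sdiff, h1, h2, h3]
    clear h1 h2 h3 hP hQ hR e
    by_cases a1 : v ∈ V1 <;> by_cases a2 : v ∈ unsat w uA <;> simp [a1, a2] <;> tauto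
  · ext v
    have h1 : v ∈ P ↔ v ∈ unsat w uB ∧ v ∉ V1 := by rw [hP]; simp
    have h2 : v ∈ Q ↔ (v ∈ unsat w uA ∨ v ∈ nbhd w P) ∧ v ∈ V1 := by rw [hQ]; simp
    have h3 : v ∈ R ↔ v ∈ nbhd w (unsat w uA ∩ V1) ∧ v ∉ V1 := by rw [hR]; simp
    simp only [Finset.mem_union, Finset.mem_inter, Finset.mem_sdiff, Finset.mem_compl, h1, h2, h3]
    clear h1 h2 h3 hP hQ hR e
    by_cases a1 : v ∈ V1 <;> by_cases a2 : v ∈ unsat w uA <;> simp [a1, a2] <;> tauto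

/-- a family `ℱ` of at most `2^{18k}` easy instances covering `(A_π, B_π)` for
all feasible cuts `π`, with feasibility of `I` equivalent to feasibility of some member. -/
theorem easy_instances_cover (w : V → V → ℕ)
    (hsymm : ∀ u v, w u v = w v u) (hloop : ∀ v, w v v = 0)
    (A B : Finset V) (uA uB : V → ℕ) (k : ℕ)
    (hA : A.Nonempty) (hB : B.Nonempty) (hAB : Disjoint A B) :
    ∃ ℱ : Finset (Finset V × Finset V), ℱ.card ≤ 2 ^ (18 * k) ∧
      (∀ p ∈ ℱ, Disjoint p.1 p.2 ∧ A ⊆ p.1 ∧ B ⊆ p.2 ∧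
        EasyInstance w uA uB p.1 p.2) ∧
      (∀ V1 : Finset V, FeasibleCut w uA uB k A B V1 →
        (Api w uA uB A V1, Bpi w uA uB B V1) ∈ ℱ) ∧
      (Feasible w uA uB k A B ↔ ∃ p ∈ ℱ, Feasible w uA uB k p.1 p.2) := by
  classical
  choose TA hTA hTA' using fun X => traces w A B X k hB
  choose TB hTB hTB' using fun X => traces w B A X k hA
  let ℱ : Finset (Finset V × Finset V) :=
    (univ.filter (fun V1 => FeasibleCut w uA uB k A B V1)).image
      (fun V1 => (Api w uA uB A V1, Bpi w uA uB B V1))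
  have hmem : ∀ p, p ∈ ℱ ↔ ∃ V1, FeasibleCut w uA uB k A B V1 ∧
      (Api w uA uB A V1, Bpi w uA uB B V1) = p := by
    intro p
    simp [ℱ]
  refine ⟨ℱ, ?_, ?_, ?_, ?_⟩
  · let 𝒢 : Finset (Finset V × Finset V) :=
      (TB (unsat w uB)).biUnion fun P => (TA (unsat w uA ∪ nbhd w P)).biUnion fun Q =>
        (TB (nbhd w (unsat w uA ∩ Q))).image fun R => recon w uA uB A B P Q R
    have hsub : ℱ ⊆ 𝒢 := by
      intro p hp
      obtain ⟨V1, hf, rfl⟩ := (hmem p).1 hp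
      obtain ⟨hmc, hk, hdA, hdB⟩ := hf
      have hcA := conn_left hmc
      have hcB := conn_right hsymm hmc
      have hk' : cutSize w V1ᶜ ≤ k := by rwa [cs_compl hsymm]
      have hd1 : Disjoint V1 B := by
        rw [Finset.disjoint_left]
        intro v hv hvB
        exact (Finset.mem_compl.1 (hmc.1.2 hvB)) hv
      have hd2 : Disjoint V1ᶜ A := by
        rw [Finset.disjoint_left]
        intro v hv hvA
        exact (Finset.mem_compl.1 hv) (hmc.1.1 hvA)
      have hP := hTB' (unsat w uB) V1ᶜ hmc.1.2 hd2 hcB hk' (fun u hu =>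
        unsat_nb hloop (Finset.mem_inter.1 hu).1 (hdB u (Finset.mem_inter.1 hu).2))
      have hQ := hTA' (unsat w uA ∪ nbhd w (unsat w uB ∩ V1ᶜ)) V1 hmc.1.1 hd1 hcA hk
        (fun u hu => by
          obtain ⟨h1, h2⟩ := Finset.mem_inter.1 hu
          rcases Finset.mem_union.1 h1 with h | h
          · exact unsat_nb hloop h (hdA u h2)
          · obtain ⟨x, hx, hw⟩ := nbhd_ex h
            exact ⟨x, by simpa using (Finset.mem_inter.1 hx).2, hw⟩)
      have hR := hTB' (nbhd w (unsat w uA ∩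
          ((unsat w uA ∪ nbhd w (unsat w uB ∩ V1ᶜ)) ∩ V1))) V1ᶜ hmc.1.2 hd2 hcB hk'
        (fun u hu => by
          obtain ⟨h, h2⟩ := Finset.mem_inter.1 hu
          obtain ⟨x, hx, hw⟩ := nbhd_ex h
          refine ⟨x, ?_, hw⟩
          have := (Finset.mem_inter.1 (Finset.mem_inter.1 hx).2).2
          simpa using this)
      refine Finset.mem_biUnion.2 ⟨_, hP, Finset.mem_biUnion.2 ⟨_, hQ,
        Finset.mem_image.2 ⟨_, hR, ?_⟩⟩⟩
      exact (recon_eq w uA uB A B V1 _ _ _ rfl rfl rfl).symm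
    calc ℱ.card ≤ 𝒢.card := Finset.card_le_card hsub
      _ ≤ (TB (unsat w uB)).card * (2 ^ (6 * k) * 2 ^ (6 * k)) := by
          apply Finset.card_biUnion_le_card_mul
          intro P _
          refine le_trans (Finset.card_biUnion_le_card_mul _ _ (2 ^ (6 * k)) ?_)
            (Nat.mul_le_mul_right _ (hTA _))
          intro Q _
          exact Finset.card_image_le.trans (hTB _)
      _ ≤ 2 ^ (6 * k) * (2 ^ (6 * k) * 2 ^ (6 * k)) := Nat.mul_le_mul_right _ (hTB _)
      _ = 2 ^ (18 * k) := by rw [← pow_add, ← pow_add]; congr 1; omega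
  · intro p hp
    obtain ⟨V1, hf, rfl⟩ := (hmem p).1 hp
    obtain ⟨h1, h2⟩ := feas_mem (w := w) (uA := uA) (uB := uB) hf.1.1
    refine ⟨?_, ?_, ?_, easy_pi hf.1.1⟩
    · exact Finset.disjoint_of_subset_left h1
        (Finset.disjoint_of_subset_right h2 disjoint_compl_right)
    · intro v hv
      simp [Api, hv]
    · intro v hv
      simp [Bpi, hv]
  · intro V1 hf
    exact (hmem _).2 ⟨V1, hf, rfl⟩
  · constructor
    · rintro ⟨V1, hf⟩
      exact ⟨_, (hmem _).2 ⟨V1, hf, rfl⟩, V1, feas_pi hf⟩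
    · rintro ⟨p, hp, -⟩
      obtain ⟨V1, hf, -⟩ := (hmem p).1 hp
      exact ⟨V1, hf⟩
end
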